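/- arXiv:2406.18299 — 4 statements merged into one kernel-verified Lean document; each statement's English description precedes it below -/
import Mathlib

section
/- Let v ∈ V ∖ {s} be an element for which no stable witness walk relative to s starting at v exists. Then every set D ⊆ V ∖ {s} with the property that every x ∈ V ∖ (D ∪ {s}) has some y ∈ V ∖ D with W(x, y) must contain v. -/
/-- The core conditions of a *witness walk relative to `s`* starting at `v`:
a sequence `w 0, w 1, …, w (j-1)` of `j ≥ 1` elements of `V`, starting at `v`,
whose elements other than the last one avoid `s` and are pairwise distinct,
and such that consecutive elements are related by `W`. -/
def IsWitnessWalkCore {V : Type*} (W : V → V → Prop) (s v : V) (j : ℕ) (w : ℕ → V) : Prop :=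
  1 ≤ j ∧ w 0 = v ∧
    (∀ i, i + 1 < j → w i ≠ s) ∧
    (∀ i₁ i₂, i₁ + 1 < j → i₂ + 1 < j → i₁ ≠ i₂ → w i₁ ≠ w i₂) ∧
    (∀ i, i + 1 < j → W (w i) (w (i + 1)))

/-- A *stable witness walk relative to `s`* starting at `v`: a witness walk that is
`s`-terminated (its last element is `s`) or returning (its last element repeats an
earlier element). -/
def IsStableWitnessWalk {V : Type*} (W : V → V → Prop) (s v : V) (j : ℕ) (w : ℕ → V) : Prop :=
  IsWitnessWalkCore W s v j w ∧
    (w (j - 1) = s ∨ ∃ i, i + 1 < j ∧ w (j - 1) = w i)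

/-- if no stable witness walk relative to `s` starts at `v ∈ V ∖ {s}`,
then every set `D ⊆ V ∖ {s}` such that every `x ∈ V ∖ (D ∪ {s})` has some
`y ∈ V ∖ D` with `W x y` must contain `v`. -/
theorem stmt_0 {V : Type*} [Fintype V] (W : V → V → Prop) (s v : V) (hvs : v ≠ s)
    (hno : ¬ ∃ (j : ℕ) (w : ℕ → V), IsStableWitnessWalk W s v j w)
    (D : Set V) (hDs : s ∉ D)
    (hD : ∀ x, x ∉ D → x ≠ s → ∃ y, y ∉ D ∧ W x y) :
    v ∈ D := by
  classical
  by_contra hv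
  have hg : ∀ x, ∃ y, x ∉ D → y ∉ D ∧ (x ≠ s → W x y) := by
    intro x
    by_cases hx : x ∈ D
    · exact ⟨x, fun h => absurd hx h⟩
    · by_cases hs : x = s
      · exact ⟨x, fun h => ⟨h, fun h' => absurd hs h'⟩⟩
      · obtain ⟨y, hy, hW⟩ := hD x hx hs
        exact ⟨y, fun _ => ⟨hy, fun _ => hW⟩⟩
  choose g hg using hg
  let w : ℕ → V := fun n => Nat.rec v (fun _ x => g x) n
  have hw0 : w 0 = v := rfl
  have hws : ∀ n, w (n + 1) = g (w n) := fun _ => rfl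
  have hwD : ∀ n, w n ∉ D := by
    intro n
    induction n with
    | zero => exact hv
    | succ k ih => rw [hws]; exact (hg _ ih).1
  have hex : ∃ n, w n = s ∨ ∃ i, i < n ∧ w n = w i := by
    obtain ⟨a, b, hab, h⟩ := Finite.exists_ne_map_eq_of_infinite w
    rcases lt_or_gt_of_ne hab with h1 | h1
    · exact ⟨b, Or.inr ⟨a, h1, h.symm⟩⟩
    · exact ⟨a, Or.inr ⟨b, h1, h⟩⟩
  have hfind : ∃ n, (w n = s ∨ ∃ i, i < n ∧ w n = w i) ∧
      ∀ m, m < n → ¬ (w m = s ∨ ∃ i, i < m ∧ w m = w i) := by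
    refine ⟨@Nat.find _ (Classical.decPred _) hex, @Nat.find_spec _ (Classical.decPred _) hex, ?_⟩
    intro m hm
    exact @Nat.find_min _ (Classical.decPred _) hex m hm
  obtain ⟨n, hsp, hmin⟩ := hfind
  refine hno ⟨n + 1, w, ⟨by omega, hw0, ?_, ?_, ?_⟩, ?_⟩
  · intro i hi h
    exact hmin i (by omega) (Or.inl h)
  · intro a b ha hb hab h
    rcases lt_or_gt_of_ne hab with h1 | h1
    · exact hmin b (by omega) (Or.inr ⟨a, h1, h.symm⟩)
    · exact hmin a (by omega) (Or.inr ⟨b, h1, h⟩)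
  · intro i hi
    rw [hws]
    exact (hg _ (hwD i)).2 (fun h => hmin i (by omega) (Or.inl h))
  · rcases hsp with h | ⟨i, hi, h⟩
    · exact Or.inl h
    · exact Or.inr ⟨i, by omega, h⟩
end

section
/- For every v ∈ V ∖ {s}: if there is a stable witness walk relative to s starting at v, then there is a stable witness walk relative to s starting at v of length at most 10. -/
lemma close_aux {V : Type*} (W : V → V → Prop) (s v : V) (hWs : ∀ y : V, ¬ W s y)
    (u : ℕ → V) (n : ℕ) (hn : n ≤ 9) (h0 : u 0 = v)
    (hs : ∀ i, i < n → W (u i) (u (i + 1)))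
    (he : u n = s ∨ ∃ i, i < n ∧ u n = u i) :
    ∃ (j : ℕ) (w : ℕ → V), j ≤ 10 ∧ IsStableWitnessWalk W s v j w := by
  classical
  have hex : ∃ n, n ≤ 9 ∧ (∀ i, i < n → W (u i) (u (i + 1))) ∧
      (u n = s ∨ ∃ i, i < n ∧ u n = u i) := ⟨n, hn, hs, he⟩
  obtain ⟨h9, hst, hend⟩ := Nat.find_spec hex
  have hmin := fun m => Nat.find_min hex (m := m)
  set k := Nat.find hex
  have hinj : ∀ a b, a < b → b < k → u b ≠ u a := fun a b hab hbk e =>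
    hmin b hbk ⟨by omega, fun i hi => hst i (by omega), Or.inr ⟨a, hab, e⟩⟩
  refine ⟨k + 1, u, by omega, ⟨by omega, h0, ?_, ?_, ?_⟩, ?_⟩
  · intro i hi e
    exact hWs _ (e ▸ hst i (by omega))
  · intro a b ha hb hab e
    rcases lt_or_gt_of_ne hab with h | h
    · exact hinj a b h (by omega) e.symm
    · exact hinj b a h (by omega) e
  · intro i hi
    exact hst i (by omega)
  · rcases hend with h | ⟨i, hi, h⟩
    · exact Or.inl h
    · exact Or.inr ⟨i, by omega, h⟩

lemma close_list {V : Type*} (W : V → V → Prop) (s v : V) (hWs : ∀ y : V, ¬ W s y)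
    (hno : ¬ ∃ (j : ℕ) (w : ℕ → V), j ≤ 10 ∧ IsStableWitnessWalk W s v j w)
    (u : ℕ → V) (n : ℕ) (hn : n ≤ 8) (h0 : u 0 = v)
    (hs : ∀ i, i < n → W (u i) (u (i + 1))) :
    (∀ i, i ≤ n → ¬ W (u n) (u i)) ∧ ¬ W (u n) s := by
  have key : ∀ y, W (u n) y → (y = s ∨ ∃ i, i ≤ n ∧ y = u i) → False := by
    intro y hy he
    apply hno
    refine close_aux W s v hWs (fun i => if i ≤ n then u i else y) (n + 1) (by omega)
      (by simpa using h0) ?_ ?_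
    · intro i hi
      rcases Nat.lt_or_ge i n with h | h
      · have h1 : i ≤ n := by omega
        have h2 : i + 1 ≤ n := by omega
        simpa [h1, h2] using hs i h
      · have : i = n := by omega
        subst this
        simpa using hy
    · rcases he with h | ⟨i, hi, h⟩
      · left; simpa using h
      · right; exact ⟨i, by omega, by simpa [hi] using h⟩
  exact ⟨fun i hi h => key _ h (Or.inr ⟨i, hi, rfl⟩), fun h => key _ h (Or.inl rfl)⟩

lemma prop_aux (P Q : Prop → Prop) (p q r : Prop) (h1 : P q) (h2 : ¬ Q q) (h3 : Q r)
    (h4 : ¬ P r) : P p ∨ Q p := by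
  by_cases hp : p <;> by_cases hq : q <;> by_cases hr : r <;>
    simp only [hp, hq, hr] at h1 h2 h3 h4 ⊢ <;> simp_all

lemma flip3 {p q r : Prop} (h1 : ¬ (p ↔ q)) (h2 : ¬ (q ↔ r)) : p ↔ r := by tauto

lemma flip4 {p q r t : Prop} (h1 : ¬ (p ↔ q)) (h2 : ¬ (q ↔ r)) (h3 : ¬ (r ↔ t)) :
    ¬ (p ↔ t) := by tauto

lemma nsymm {p q : Prop} (h1 : ¬ (p ↔ q)) : ¬ (q ↔ p) := fun h => h1 h.symm

theorem stmt_2 {V : Type*} [Fintype V] (G : SimpleGraph V) (s : V)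
    (W : V → V → Prop) (f : Prop → Prop → Prop → Prop → Prop → Prop)
    (hW : ∀ x y : V, x ≠ s →
      (W x y ↔ f (x = y) (y = s) (G.Adj x y) (G.Adj x s) (G.Adj y s)))
    (hWs : ∀ y : V, ¬ W s y) :
    ∀ v : V, v ≠ s →
      (∃ (j : ℕ) (w : ℕ → V), IsStableWitnessWalk W s v j w) →
      ∃ (j : ℕ) (w : ℕ → V), j ≤ 10 ∧ IsStableWitnessWalk W s v j w := by
  classical
  rintro v hv ⟨j, w, ⟨hj, hw0, hws, hwi, hwW⟩, hend⟩
  by_contra hno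
  have cl := close_list W s v hWs hno
  have ne : ∀ {x y}, W x y → x ≠ s := fun h e => hWs _ (e ▸ h)
  -- symmetry inside a class
  have sym : ∀ x y, y ≠ s → (G.Adj x s ↔ G.Adj y s) → W x y → W y x := by
    intro x y hy hc h
    have hx := ne h
    rw [hW x y hx] at h
    rw [hW y x hy]
    have e1 : (y = x) = (x = y) := propext eq_comm
    have e2 : (y = s) = (x = s) := by simp [hx, hy]
    have e3 : G.Adj y x = G.Adj x y := propext (G.adj_comm _ _)
    have e4 : G.Adj x s = G.Adj y s := propext hc
    rw [e1, e3, ← e2]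
    rw [e4] at h ⊢
    exact h
  have n1 : ∀ a, W v a → ¬ W a v ∧ ¬ W a s := by
    intro a h1
    have := cl (fun i => if i = 0 then v else a) 1 (by omega) rfl
      (by intro i hi; interval_cases i <;> simpa)
    exact ⟨by simpa using this.1 0 (by omega), by simpa using this.2⟩
  have n2 : ∀ a b, W v a → W a b → ¬ W b a := by
    intro a b h1 h2
    have := cl (fun i => if i = 0 then v else if i = 1 then a else b) 2 (by omega) rfl
      (by intro i hi; interval_cases i <;> simpa)
    simpa using this.1 1 (by omega)
  have n3 : ∀ a b c, W v a → W a b → W b c → ¬ W c b ∧ ¬ W c v := by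
    intro a b c h1 h2 h3
    have := cl (fun i => if i = 0 then v else if i = 1 then a else if i = 2 then b else c)
      3 (by omega) rfl (by intro i hi; interval_cases i <;> simpa)
    exact ⟨by simpa using this.1 2 (by omega), by simpa using this.1 0 (by omega)⟩
  have n4 : ∀ a b c d, W v a → W a b → W b c → W c d → ¬ W d c ∧ ¬ W d a := by
    intro a b c d h1 h2 h3 h4
    have := cl (fun i => if i = 0 then v else if i = 1 then a else if i = 2 then b
      else if i = 3 then c else d)
      4 (by omega) rfl (by intro i hi; interval_cases i <;> simpa)
    exact ⟨by simpa using this.1 3 (by omega), by simpa using this.1 1 (by omega)⟩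
  rcases hend with hend | ⟨i, hi, hend⟩
  · -- s-terminated
    have hvs : ¬ W v s := (cl (fun _ => v) 0 (by omega) rfl (by simp)).2
    have hj1 : j ≠ 1 := by rintro rfl; exact hv (hw0 ▸ hend)
    have hx := hwW (j - 2) (by omega)
    rw [show j - 2 + 1 = j - 1 by omega, hend] at hx
    have hj2 : j ≠ 2 := by rintro rfl; exact hvs (hw0 ▸ hx)
    have h1 := hwW 0 (by omega)
    have hs1 := hws 1 (by omega)
    rw [hw0] at h1
    simp only [zero_add] at h1
    obtain ⟨h2, h3⟩ := n1 _ h1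
    have hcl : ¬ (G.Adj v s ↔ G.Adj (w 1) s) := fun h => h2 (sym _ _ hs1 h h1)
    have tr : ∀ x y, y ≠ s → (G.Adj x s ↔ G.Adj y s) → W x s → W y s := by
      intro x y hy hc h
      have hx := ne h
      rw [hW x s hx] at h
      rw [hW y s hy]
      have e4 : G.Adj x s = G.Adj y s := propext hc
      rw [e4] at h
      simpa [hx, hy] using h
    by_cases hc : (G.Adj (w (j-2)) s ↔ G.Adj v s)
    · exact hvs (tr _ _ hv hc hx)
    · exact h3 (tr _ _ hs1 (by tauto) hx)
  · -- returning: infinite walk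
    have hinf : ∃ u : ℕ → V, u 0 = v ∧ ∀ n, W (u n) (u (n + 1)) := by
      let g : ℕ → ℕ := fun n => if n + 1 = j - 1 then i else n + 1
      have hg : ∀ n, g^[n] 0 + 1 < j := by
        intro n
        induction n with
        | zero => simp; omega
        | succ n ih =>
          rw [Function.iterate_succ_apply']
          simp only [g] at ih ⊢
          split_ifs <;> omega
      refine ⟨fun n => w (g^[n] 0), hw0, fun n => ?_⟩
      have h := hwW _ (hg n)
      simp only [Function.iterate_succ_apply']
      generalize g^[n] 0 = k at h
      simp only [g]
      split_ifs with hk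
      · rw [hk, hend] at h; exact h
      · exact h
    obtain ⟨u, hu0, hu⟩ := hinf
    have h01 := hu 0
    rw [hu0] at h01
    simp only [zero_add] at h01
    have h12 := hu 1
    have us : ∀ n, u n ≠ s := fun n => ne (hu n)
    have c01 : ¬ (G.Adj v s ↔ G.Adj (u 1) s) := fun h => (n1 _ h01).1 (sym _ _ (us 1) h h01)
    have c12 : ¬ (G.Adj (u 1) s ↔ G.Adj (u 2) s) :=
      fun h => n2 _ _ h01 h12 (sym _ _ (us 2) h h12)
    have tour : ∀ x y, x ≠ s → y ≠ s → ¬ (G.Adj x s ↔ G.Adj y s) → W x y ∨ W y x := by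
      have half : ∀ x y, x ≠ s → y ≠ s → (G.Adj x s ↔ G.Adj v s) →
          (G.Adj y s ↔ G.Adj (u 1) s) → W x y ∨ W y x := by
        intro x y hx hy hcx hcy
        have cxy : ¬ (G.Adj x s ↔ G.Adj y s) := by rw [hcx, hcy]; exact c01
        have k1 := h01
        have k2 := (n1 _ h01).1
        have k3 := h12
        have k4 := n2 _ _ h01 h12
        have d : ∀ a b, ¬ (G.Adj a s ↔ G.Adj b s) → (a = b) = False := by
          intro a b h
          simp only [eq_iff_iff, iff_false]
          rintro rfl; exact h Iff.rfl
        have ez : ∀ a, a ≠ s → (a = s) = False := fun a h => by simp [h]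
        rw [hW _ _ hv, d _ _ c01, ez _ (us 1)] at k1
        rw [hW _ _ (us 1), d _ _ (nsymm c01), ez _ hv, G.adj_comm] at k2
        rw [hW _ _ (us 1), d _ _ c12, ez _ (us 2)] at k3
        rw [hW _ _ (us 2), d _ _ (nsymm c12), ez _ (us 1), G.adj_comm] at k4
        rw [hW x y hx, hW y x hy, d x y cxy, d y x (nsymm cxy), ez _ hx, ez _ hy,
          G.adj_comm y x]
        have e2 : G.Adj (u 2) s = G.Adj v s := propext (flip3 c01 c12).symm
        rw [e2] at k3 k4
        rw [propext hcx, propext hcy]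
        exact prop_aux (fun e => f False False e (G.Adj v s) (G.Adj (u 1) s))
          (fun e => f False False e (G.Adj (u 1) s) (G.Adj v s)) _ _ _ k1 k2 k3 k4
      intro x y hx hy hc
      by_cases h : (G.Adj x s ↔ G.Adj v s)
      · exact half x y hx hy h (flip3 (fun e => hc (h.trans e.symm)) c01)
      · exact (half y x hy hx (flip3 (nsymm hc) h) (flip3 h c01)).symm
    have A : ∀ m, W v (u (2 * m + 1)) ∧ ¬ (G.Adj v s ↔ G.Adj (u (2 * m + 1)) s) := by
      intro m
      induction m with
      | zero => exact ⟨h01, c01⟩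
      | succ m ih =>
        obtain ⟨a, b⟩ := ih
        have p1 := hu (2 * m + 1)
        have p2 := hu (2 * m + 1 + 1)
        rw [show 2 * (m + 1) + 1 = 2 * m + 1 + 1 + 1 by ring]
        have q1 : ¬ (_ ↔ _) := fun h => n2 _ _ a p1 (sym _ _ (us _) h p1)
        have q2 : ¬ (_ ↔ _) := fun h => (n3 _ _ _ a p1 p2).1 (sym _ _ (us _) h p2)
        have q3 : ¬ (G.Adj v s ↔ G.Adj (u (2 * m + 1 + 1 + 1)) s) := flip4 b q1 q2
        exact ⟨(tour _ _ hv (us _) q3).resolve_right (n3 _ _ _ a p1 p2).2, q3⟩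
    have B : ∀ k m, W (u (2 * k + 1)) (u (2 * k + 1 + 2 * m + 1)) ∧
        ¬ (G.Adj (u (2 * k + 1)) s ↔ G.Adj (u (2 * k + 1 + 2 * m + 1)) s) := by
      intro k m
      have a0 := (A k).1
      induction m with
      | zero =>
        have p1 := hu (2 * k + 1)
        exact ⟨p1, fun h => n2 _ _ a0 p1 (sym _ _ (us _) h p1)⟩
      | succ m ih =>
        obtain ⟨a, b⟩ := ih
        have p1 := hu (2 * k + 1 + 2 * m + 1)
        have p2 := hu (2 * k + 1 + 2 * m + 1 + 1)
        rw [show 2 * k + 1 + 2 * (m + 1) + 1 = 2 * k + 1 + 2 * m + 1 + 1 + 1 by ring]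
        have q1 : ¬ (_ ↔ _) := fun h => (n3 _ _ _ a0 a p1).1 (sym _ _ (us _) h p1)
        have q2 : ¬ (_ ↔ _) := fun h => (n4 _ _ _ _ a0 a p1 p2).1 (sym _ _ (us _) h p2)
        have q3 : ¬ (G.Adj (u (2 * k + 1)) s ↔
          G.Adj (u (2 * k + 1 + 2 * m + 1 + 1 + 1)) s) := flip4 b q1 q2
        exact ⟨(tour _ _ (us _) (us _) q3).resolve_right (n4 _ _ _ _ a0 a p1 p2).2, q3⟩
    have fin : ∀ k l, k < l → u (2 * k + 1) = u (2 * l + 1) → False := by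
      intro k l hkl e
      obtain ⟨m, rfl⟩ := Nat.exists_eq_add_of_lt hkl
      have p := hu (2 * k + 1 + 2 * m + 1)
      rw [show 2 * k + 1 + 2 * m + 1 + 1 = 2 * (k + m + 1) + 1 by ring, ← e] at p
      exact n2 _ _ (A k).1 (B k m).1 p
    obtain ⟨k, l, hkl, e⟩ := Finite.exists_ne_map_eq_of_infinite (fun k : ℕ => u (2 * k + 1))
    rcases lt_or_gt_of_ne hkl with h | h
    · exact fin _ _ h e
    · exact fin _ _ h e.symm
end

section
/- If t is reachable from s by a directed path in G, then there is a set D of at most k vertices of G′ such that the induced subgraph G′ ∖ D satisfies property P. -/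
/-- A directed graph on `Fin n × Fin k` (layer `i+1`, 1-based, is `Fin n × {i}`) is a
*matched layered graph* if every edge goes from a layer to the next one, every vertex
outside the last layer has exactly one out-neighbor, and every vertex outside the
first layer has exactly one in-neighbor. -/
def MatchedLayered {n k : ℕ} (E : Fin n × Fin k → Fin n × Fin k → Prop) : Prop :=
  (∀ v w, E v w → (w.2 : ℕ) = (v.2 : ℕ) + 1) ∧
    (∀ v, (v.2 : ℕ) + 1 < k → ∃! w, E v w) ∧
    (∀ w, 0 < (w.2 : ℕ) → ∃! v, E v w)

/-- The vertex set of the graph `G′`: the original vertices, the vertices `v⁺`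
(for ends `v = (a, t.2)` of paths with `v ≠ t`), the vertices `v⁰` and `v⁻`
(for beginnings `v = (a, s.2)` of paths with `v ≠ s`), and the two vertices
`c₁* , c₂*` (encoded by `Fin 2`). -/
def Vert (n k : ℕ) (s t : Fin n × Fin k) : Type :=
  (Fin n × Fin k) ⊕
    ({a : Fin n // a ≠ t.1} ⊕ ({a : Fin n // a ≠ s.1} ⊕ ({a : Fin n // a ≠ s.1} ⊕ Fin 2)))

/-- The (1-based) layer of a vertex of `G′`, in `{-1, 0, 1, …, k+1}`; the two vertices
`c₁*, c₂*` lie in no layer. -/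
def layer {n k : ℕ} {s t : Fin n × Fin k} : Vert n k s t → Option ℤ
  | Sum.inl (_, i) => some ((i : ℕ) + 1)
  | Sum.inr (Sum.inl _) => some ((k : ℤ) + 1)
  | Sum.inr (Sum.inr (Sum.inl _)) => some 0
  | Sum.inr (Sum.inr (Sum.inr (Sum.inl _))) => some (-1)
  | Sum.inr (Sum.inr (Sum.inr (Sum.inr _))) => none

/-- The edges of `G′`: the underlying undirected edges of `G`; the edge `{v, v⁺}` for
each path end `v ≠ t`; the triangle `{v, v⁰}, {v⁰, v⁻}, {v⁻, v}` for each path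
beginning `v ≠ s`; and, for every vertex `w` lying in a layer `i`, the edge `{c₁*, w}`
if `i ≡ 0 (mod 3)`, the edge `{c₂*, w}` if `i ≡ 1 (mod 3)`, and both edges if
`i ≡ 2 (mod 3)`. -/
inductive GRel {n k : ℕ} (E : Fin n × Fin k → Fin n × Fin k → Prop) (s t : Fin n × Fin k) :
    Vert n k s t → Vert n k s t → Prop
  | base {v w} : E v w → GRel E s t (Sum.inl v) (Sum.inl w)
  | plus (a : {a : Fin n // a ≠ t.1}) :
      GRel E s t (Sum.inl (a.1, t.2)) (Sum.inr (Sum.inl a))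
  | zero (a : {a : Fin n // a ≠ s.1}) :
      GRel E s t (Sum.inl (a.1, s.2)) (Sum.inr (Sum.inr (Sum.inl a)))
  | zeroMinus (a : {a : Fin n // a ≠ s.1}) :
      GRel E s t (Sum.inr (Sum.inr (Sum.inl a))) (Sum.inr (Sum.inr (Sum.inr (Sum.inl a))))
  | minusBase (a : {a : Fin n // a ≠ s.1}) :
      GRel E s t (Sum.inr (Sum.inr (Sum.inr (Sum.inl a)))) (Sum.inl (a.1, s.2))
  | cOne {w : Vert n k s t} {i : ℤ} : layer w = some i → (i % 3 = 0 ∨ i % 3 = 2) →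
      GRel E s t (Sum.inr (Sum.inr (Sum.inr (Sum.inr 0)))) w
  | cTwo {w : Vert n k s t} {i : ℤ} : layer w = some i → (i % 3 = 1 ∨ i % 3 = 2) →
      GRel E s t (Sum.inr (Sum.inr (Sum.inr (Sum.inr 1)))) w

/-- Property `P` of an undirected simple graph `H`. -/
def PropP {X : Type*} (H : SimpleGraph X) : Prop :=
  ∃ c₁ c₂ : X, ∀ x : X, x ≠ c₁ → x ≠ c₂ → ∃ y : X,
    y ≠ c₁ ∧ y ≠ c₂ ∧ c₁ ≠ c₂ ∧ (H.Adj x c₁ ∨ H.Adj x c₂) ∧ H.Adj x y ∧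
      (H.Adj x c₁ ∧ H.Adj x c₂ → H.Adj y c₂ ∧ ¬ H.Adj y c₁) ∧
      (¬ H.Adj x c₁ ∧ H.Adj x c₂ → H.Adj y c₁ ∧ ¬ H.Adj y c₂) ∧
      (H.Adj x c₁ ∧ ¬ H.Adj x c₂ → H.Adj y c₁ ∧ H.Adj y c₂)

def cv {n k : ℕ} (s t : Fin n × Fin k) (c : Fin 2) : Vert n k s t :=
  Sum.inr (Sum.inr (Sum.inr (Sum.inr c)))

theorem adj_c1 {n k : ℕ} (E : Fin n × Fin k → Fin n × Fin k → Prop) (s t : Fin n × Fin k)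
    (x : Vert n k s t) (i : ℤ) (hx : layer x = some i) :
    (SimpleGraph.fromRel (GRel E s t)).Adj x (cv s t 0) ↔
      (i % 3 = 0 ∨ i % 3 = 2) := by
  rw [SimpleGraph.fromRel_adj]
  constructor
  · rintro ⟨_, h | h⟩
    · generalize hz : cv s t 0 = z at h
      cases h <;> first | (cases hz; done) | (cases hx; done)
    · generalize hz : cv s t 0 = z at h
      cases h with
      | cOne h1 h2 => rw [hx] at h1; cases h1; exact h2
      | cTwo h1 h2 => cases hz
      | _ => cases hz
  · intro h
    refine ⟨?_, Or.inr (GRel.cOne hx h)⟩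
    rintro rfl
    simp [layer, cv] at hx

theorem adj_c2 {n k : ℕ} (E : Fin n × Fin k → Fin n × Fin k → Prop) (s t : Fin n × Fin k)
    (x : Vert n k s t) (i : ℤ) (hx : layer x = some i) :
    (SimpleGraph.fromRel (GRel E s t)).Adj x (cv s t 1) ↔
      (i % 3 = 1 ∨ i % 3 = 2) := by
  rw [SimpleGraph.fromRel_adj]
  constructor
  · rintro ⟨_, h | h⟩
    · generalize hz : cv s t 1 = z at h
      cases h <;> first | (cases hz; done) | (cases hx; done)
    · generalize hz : cv s t 1 = z at h
      cases h with
      | cTwo h1 h2 => rw [hx] at h1; cases h1; exact h2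
      | cOne h1 h2 => cases hz
      | _ => cases hz
  · intro h
    refine ⟨?_, Or.inr (GRel.cTwo hx h)⟩
    rintro rfl
    simp [layer, cv] at hx

theorem reach_zero {n k : ℕ} (E : Fin n × Fin k → Fin n × Fin k → Prop)
    (hE : MatchedLayered E) (s v : Fin n × Fin k)
    (hv : (v.2 : ℕ) = 0) (h : Relation.ReflTransGen E s v) : v = s := by
  cases h with
  | refl => rfl
  | tail _ h2 => have := hE.1 _ _ h2; omega

theorem reach_inj {n k : ℕ} (E : Fin n × Fin k → Fin n × Fin k → Prop)
    (hE : MatchedLayered E) (s : Fin n × Fin k) (hs : (s.2 : ℕ) = 0) :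
    ∀ (m : ℕ) (v w : Fin n × Fin k), (v.2 : ℕ) = m → (w.2 : ℕ) = m →
      Relation.ReflTransGen E s v → Relation.ReflTransGen E s w → v = w := by
  intro m
  induction m with
  | zero =>
    intro v w hv hw h1 h2
    rw [reach_zero E hE s v hv h1, reach_zero E hE s w hw h2]
  | succ m ih =>
    intro v w hv hw h1 h2
    cases h1 with
    | refl => omega
    | @tail v' _ a1 b1 =>
    cases h2 with
    | refl => omega
    | @tail w' _ a2 b2 =>
    have e1 := hE.1 _ _ b1
    have e2 := hE.1 _ _ b2
    have := ih v' w' (by omega) (by omega) a1 a2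
    subst this
    exact (hE.2.1 v' (by have := v.2.2; omega)).unique b1 b2

/-- if `t` is reachable from `s` in the matched layered graph `G`, then
at most `k` vertices can be deleted from `G′` so that the remaining induced subgraph
satisfies property `P`. -/
theorem stmt_6 {n k : ℕ} (E : Fin n × Fin k → Fin n × Fin k → Prop)
    (hE : MatchedLayered E) (s t : Fin n × Fin k)
    (hs : (s.2 : ℕ) = 0) (ht : (t.2 : ℕ) + 1 = k)
    (hreach : Relation.ReflTransGen E s t) :
    ∃ D : Set (Vert n k s t), D.ncard ≤ k ∧
      PropP ((SimpleGraph.fromRel (GRel E s t)).induce Dᶜ) := by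
  let D0 : Set (Fin n × Fin k) := {v | Relation.ReflTransGen E s v}
  let f : Fin n × Fin k → Vert n k s t := fun v => Sum.inl v
  have hf : ∀ v, f v ∈ f '' D0 → Relation.ReflTransGen E s v := by
    rintro v ⟨w, hw, h⟩
    have : w = v := Sum.inl.inj h
    subst this
    exact hw
  have key : ∀ x : Vert n k s t, x ∉ f '' D0 → ∀ i, layer x = some i →
      ∃ y : Vert n k s t, y ∉ f '' D0 ∧
        (GRel E s t x y ∨ GRel E s t y x) ∧ x ≠ y ∧ ∃ j, layer y = some j ∧ (i - 1 - j) % 3 = 0 := by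
    intro x hx i hi
    rcases x with v | a | a | a | c
    · have hv : ¬ Relation.ReflTransGen E s v := fun h => hx ⟨v, h, rfl⟩
      have hi' : ((v.2 : ℕ) : ℤ) + 1 = i := by
        simpa [layer] using hi
      by_cases h0 : (v.2 : ℕ) = 0
      · have hvs : v.2 = s.2 := Fin.ext (by omega)
        have hne : v.1 ≠ s.1 := by
          intro h
          exact hv (by rw [Prod.ext h hvs])
        refine ⟨Sum.inr (Sum.inr (Sum.inl ⟨v.1, hne⟩)), ?_, Or.inl ?_, ?_, 0, rfl, by omega⟩
        · rintro ⟨w, _, h⟩; cases h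
        · have := GRel.zero (E := E) (s := s) (t := t) ⟨v.1, hne⟩
          rwa [← hvs] at this
        · intro h; cases h
      · obtain ⟨w, hw, -⟩ := hE.2.2 v (by omega)
        have hl := hE.1 _ _ hw
        refine ⟨Sum.inl w, ?_, Or.inr (GRel.base hw), ?_, ((w.2 : ℕ) : ℤ) + 1, rfl, by omega⟩
        · intro h
          exact hv ((hf w h).tail hw)
        · intro h
          have := Sum.inl.inj h
          subst this
          omega
    · have hi' : (k : ℤ) + 1 = i := by simpa [layer] using hi
      refine ⟨Sum.inl (a.1, t.2), ?_, Or.inr (GRel.plus a), ?_, ((t.2 : ℕ) : ℤ) + 1, rfl, by omega⟩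
      · intro h
        have := reach_inj E hE s hs _ (a.1, t.2) t rfl rfl (hf _ h) hreach
        exact a.2 (congrArg Prod.fst this)
      · intro h; cases h
    · have hi' : 0 = i := by simpa [layer] using hi
      refine ⟨Sum.inr (Sum.inr (Sum.inr (Sum.inl a))), ?_, Or.inl (GRel.zeroMinus a), ?_, -1, rfl,
        by omega⟩
      · rintro ⟨w, _, h⟩; cases h
      · intro h; cases h
    · have hi' : -1 = i := by simpa [layer] using hi
      refine ⟨Sum.inl (a.1, s.2), ?_, Or.inl (GRel.minusBase a), ?_, ((s.2 : ℕ) : ℤ) + 1, rfl,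
        by omega⟩
      · intro h
        have := reach_zero E hE s (a.1, s.2) hs (hf _ h)
        exact a.2 (congrArg Prod.fst this)
      · intro h; cases h
    · simp [layer] at hi
  refine ⟨f '' D0, ?_, ?_⟩
  · refine (Set.ncard_image_le (Set.toFinite _)).trans ?_
    have h1 : D0.ncard ≤ (Set.univ : Set (Fin k)).ncard := by
      refine Set.ncard_le_ncard_of_injOn Prod.snd (fun _ _ => Set.mem_univ _) ?_ (Set.toFinite _)
      intro v hv w hw h
      exact reach_inj E hE s hs _ v w rfl (by rw [h]) hv hw
    simpa [Set.ncard_univ] using h1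
  · let C : Fin 2 → Vert n k s t := cv s t
    have hC : ∀ c, C c ∉ f '' D0 := by
      rintro c ⟨w, _, h⟩; cases h
    have hlC : ∀ c, layer (C c) = none := fun c => rfl
    refine ⟨⟨C 0, hC 0⟩, ⟨C 1, hC 1⟩, ?_⟩
    rintro ⟨x, hx⟩ hx1 hx2
    have hl : ∃ i, layer x = some i := by
      rcases x with v | a | a | a | c
      · exact ⟨_, rfl⟩
      · exact ⟨_, rfl⟩
      · exact ⟨_, rfl⟩
      · exact ⟨_, rfl⟩
      · exfalso
        fin_cases c
        · exact hx1 rfl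
        · exact hx2 rfl
    obtain ⟨i, hi⟩ := hl
    obtain ⟨y, hy, hadj, hne, j, hj, hij⟩ := key x hx i hi
    have a1 := adj_c1 E s t x i hi
    have a2 := adj_c2 E s t x i hi
    have b1 := adj_c1 E s t y j hj
    have b2 := adj_c2 E s t y j hj
    refine ⟨⟨y, hy⟩, ?_, ?_, ?_, ?_⟩
    · intro h
      have h' : y = C 0 := congrArg Subtype.val h
      rw [h', hlC] at hj; cases hj
    · intro h
      have h' : y = C 1 := congrArg Subtype.val h
      rw [h', hlC] at hj; cases hj
    · intro h
      have h' : C 0 = C 1 := congrArg Subtype.val h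
      cases h'
    · have hxy : (SimpleGraph.fromRel (GRel E s t)).Adj x y :=
        (SimpleGraph.fromRel_adj _ _ _).2 ⟨hne, hadj⟩
      simp only [SimpleGraph.comap_adj, Function.Embedding.subtype_apply]
      change (_ ∨ _) ∧ _
      simp only [C, a1, a2, b1, b2, hxy, true_and]
      omega
end

section
/- If there is a set D of at most k vertices of G′ such that the induced subgraph G′ ∖ D satisfies property P, then t is reachable from s by a directed path in G. -/
/-- The pairing condition of `PropP`, unfolded on the ambient graph. -/
def Good {V : Type*} (G : SimpleGraph V) (D : Set V) (c₁ c₂ : V) : Prop :=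
  ∀ x, x ∉ D → x ≠ c₁ → x ≠ c₂ → ∃ y, y ∉ D ∧
    y ≠ c₁ ∧ y ≠ c₂ ∧ (G.Adj x c₁ ∨ G.Adj x c₂) ∧ G.Adj x y ∧
      (G.Adj x c₁ ∧ G.Adj x c₂ → G.Adj y c₂ ∧ ¬ G.Adj y c₁) ∧
      (¬ G.Adj x c₁ ∧ G.Adj x c₂ → G.Adj y c₁ ∧ ¬ G.Adj y c₂) ∧
      (G.Adj x c₁ ∧ ¬ G.Adj x c₂ → G.Adj y c₁ ∧ G.Adj y c₂)

lemma good_of_propP {V : Type*} (G : SimpleGraph V) (D : Set V) (h : PropP (G.induce Dᶜ)) :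
    ∃ c₁ c₂, c₁ ∉ D ∧ c₂ ∉ D ∧ Good G D c₁ c₂ ∧
      ∀ x, x ∉ D → x ≠ c₁ → x ≠ c₂ → c₁ ≠ c₂ := by
  obtain ⟨⟨c₁, h1⟩, ⟨c₂, h2⟩, h⟩ := h
  refine ⟨c₁, c₂, h1, h2, ?_, ?_⟩
  swap
  · intro x hx hx1 hx2
    obtain ⟨_, _, _, a, _⟩ := h ⟨x, hx⟩ (by simpa using hx1) (by simpa using hx2)
    simpa using a
  intro x hx hx1 hx2
  obtain ⟨⟨y, hy⟩, a, b, _, c⟩ := h ⟨x, hx⟩ (by simpa using hx1) (by simpa using hx2)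
  refine ⟨y, hy, by simpa using a, by simpa using b, ?_⟩
  simpa using c

section core
variable {V : Type*} {G : SimpleGraph V} {D S Lay : Set V} {c₁ c₂ σ τ : V}

lemma good_A (h : Good G D c₁ c₂) {x} (hx : x ∉ D) (h1 : x ≠ c₁) (h2 : x ≠ c₂)
    (a1 : G.Adj x c₁) (a2 : G.Adj x c₂) :
    ∃ y, y ∉ D ∧ y ≠ c₁ ∧ y ≠ c₂ ∧ G.Adj x y ∧ ¬ G.Adj y c₁ ∧ G.Adj y c₂ := by
  obtain ⟨y, hy, e1, e2, _, e4, e5, e6, e7⟩ := h x hx h1 h2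
  exact ⟨y, hy, e1, e2, e4, (e5 ⟨a1, a2⟩).2, (e5 ⟨a1, a2⟩).1⟩

lemma good_B (h : Good G D c₁ c₂) {x} (hx : x ∉ D) (h1 : x ≠ c₁) (h2 : x ≠ c₂)
    (a1 : ¬ G.Adj x c₁) (a2 : G.Adj x c₂) :
    ∃ y, y ∉ D ∧ y ≠ c₁ ∧ y ≠ c₂ ∧ G.Adj x y ∧ G.Adj y c₁ ∧ ¬ G.Adj y c₂ := by
  obtain ⟨y, hy, e1, e2, _, e4, e5, e6, e7⟩ := h x hx h1 h2
  exact ⟨y, hy, e1, e2, e4, e6 ⟨a1, a2⟩⟩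

lemma good_C (h : Good G D c₁ c₂) {x} (hx : x ∉ D) (h1 : x ≠ c₁) (h2 : x ≠ c₂)
    (a1 : G.Adj x c₁) (a2 : ¬ G.Adj x c₂) :
    ∃ y, y ∉ D ∧ y ≠ c₁ ∧ y ≠ c₂ ∧ G.Adj x y ∧ G.Adj y c₁ ∧ G.Adj y c₂ := by
  obtain ⟨y, hy, e1, e2, _, e4, e5, e6, e7⟩ := h x hx h1 h2
  exact ⟨y, hy, e1, e2, e4, e7 ⟨a1, a2⟩⟩

lemma good_dom (h : Good G D c₁ c₂) {x} (hx : x ∉ D) (h1 : x ≠ c₁) (h2 : x ≠ c₂) :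
    G.Adj x c₁ ∨ G.Adj x c₂ := by
  obtain ⟨y, _, _, _, e, _⟩ := h x hx h1 h2
  exact e

/-- From any noncentral vertex one gets one adjacent to both centres. -/
lemma good_exA (h : Good G D c₁ c₂) {x} (hx : x ∉ D) (h1 : x ≠ c₁) (h2 : x ≠ c₂) :
    ∃ y, y ∉ D ∧ y ≠ c₁ ∧ y ≠ c₂ ∧ G.Adj y c₁ ∧ G.Adj y c₂ := by
  have hC : ∀ {x}, x ∉ D → x ≠ c₁ → x ≠ c₂ → G.Adj x c₁ → 
      ∃ y, y ∉ D ∧ y ≠ c₁ ∧ y ≠ c₂ ∧ G.Adj y c₁ ∧ G.Adj y c₂ := by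
    intro x hx h1 h2 a
    by_cases b : G.Adj x c₂
    · exact ⟨x, hx, h1, h2, a, b⟩
    · obtain ⟨y, p, q, r, _, u⟩ := good_C h hx h1 h2 a b
      exact ⟨y, p, q, r, u⟩
  by_cases a : G.Adj x c₁
  · exact hC hx h1 h2 a
  · have b := (good_dom h hx h1 h2).resolve_left a
    obtain ⟨y, p, q, r, _, u, _⟩ := good_B h hx h1 h2 a b
    exact hC p q r u

/-- Both centres layered: impossible. -/
lemma core0 (h : Good G D c₁ c₂)
    (hstar : ∀ x y, x ∉ Lay → G.Adj x y → y ∈ Lay)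
    (hS : ∀ x y, x ∈ Lay → y ∈ Lay → G.Adj x y → (x ∈ S ↔ y ∈ S))
    (l1 : c₁ ∈ Lay) (l2 : c₂ ∈ Lay)
    (hu : ∃ u, u ∉ D ∧ u ∈ Lay ∧ u ∈ S) (hw : ∃ u, u ∉ D ∧ u ∈ Lay ∧ u ∉ S)
    (hx : ∃ x, x ∉ D ∧ x ≠ c₁ ∧ x ≠ c₂) : False := by
  have key : ∀ u, u ∉ D → u ∈ Lay → ((u ∈ S ↔ c₁ ∈ S) ∨ (u ∈ S ↔ c₂ ∈ S)) := by
    intro u hu hl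
    by_cases e1 : u = c₁
    · subst e1; exact Or.inl Iff.rfl
    by_cases e2 : u = c₂
    · subst e2; exact Or.inr Iff.rfl
    rcases good_dom h hu e1 e2 with a | a
    · exact Or.inl (hS _ _ hl l1 a)
    · exact Or.inr (hS _ _ hl l2 a)
  have side : ¬ (c₁ ∈ S ↔ c₂ ∈ S) := by
    obtain ⟨u, a, b, c⟩ := hu
    obtain ⟨w, a', b', c'⟩ := hw
    have := key u a b
    have := key w a' b'
    tauto
  have noA : ∀ x, x ∈ Lay → G.Adj x c₁ → G.Adj x c₂ → False := fun x hx a b =>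
    side ((hS _ _ hx l1 a).symm.trans (hS _ _ hx l2 b))
  obtain ⟨x, hx, h1, h2⟩ := hx
  obtain ⟨p, hp, p1, p2, pa, pb⟩ := good_exA h hx h1 h2
  have hpl : p ∉ Lay := fun hl => noA p hl pa pb
  obtain ⟨y, hy, y1, y2, py, ya, yb⟩ := good_A h hp p1 p2 pa pb
  have yl := hstar _ _ hpl py
  obtain ⟨z, hz, z1, z2, yz, za, zb⟩ := good_B h hy y1 y2 ya yb
  have zl : z ∉ Lay := fun zl =>
    side (((hS _ _ zl l1 za).symm.trans (hS _ _ yl zl yz).symm).trans (hS _ _ yl l2 yb))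
  obtain ⟨q, hq, q1, q2, zq, qa, qb⟩ := good_C h hz z1 z2 za zb
  exact noA q (hstar _ _ zl zq) qa qb

/-- First centre a star, the second layered: impossible. -/
lemma core1b (h : Good G D σ c₂)
    (hstar : ∀ x y, x ∉ Lay → G.Adj x y → y ∈ Lay)
    (hS : ∀ x y, x ∈ Lay → y ∈ Lay → G.Adj x y → (x ∈ S ↔ y ∈ S))
    (l1 : σ ∉ Lay) (l2 : c₂ ∈ Lay)
    (hu : ∃ u, u ∉ D ∧ u ∈ Lay ∧ ¬ (u ∈ S ↔ c₂ ∈ S)) : False := by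
  obtain ⟨u, hu, ul, us⟩ := hu
  have u1 : u ≠ σ := by rintro rfl; exact l1 ul
  have u2 : u ≠ c₂ := by rintro rfl; exact us Iff.rfl
  have ub : ¬ G.Adj u c₂ := fun a => us (hS _ _ ul l2 a)
  have ua := (good_dom h hu u1 u2).resolve_right ub
  obtain ⟨y, hy, y1, y2, uy, ya, yb⟩ := good_C h hu u1 u2 ua ub
  have yl := hstar _ _ l1 ya.symm
  exact us ((hS _ _ ul yl uy).trans (hS _ _ yl l2 yb))

/-- Second centre a star, the first layered: impossible. -/
lemma core1a (h : Good G D c₁ σ)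
    (hall : ∀ x, x ∉ Lay → x = σ ∨ x = τ)
    (hstar : ∀ x y, x ∉ Lay → G.Adj x y → y ∈ Lay)
    (hS : ∀ x y, x ∈ Lay → y ∈ Lay → G.Adj x y → (x ∈ S ↔ y ∈ S))
    (h2 : ∀ a b, a ∈ Lay → b ∈ Lay → G.Adj a b → G.Adj a σ → G.Adj a τ → G.Adj b σ →
      ¬ G.Adj b τ)
    (h3 : ∀ x y z w, x ∈ Lay → y ∈ Lay → z ∈ Lay → w ∈ Lay → G.Adj x y → G.Adj y z →
      G.Adj x z → G.Adj x w → w ≠ y → w ≠ z → G.Adj w τ)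
    (l1 : c₁ ∈ Lay) (l2 : σ ∉ Lay) (l3 : τ ∉ Lay)
    (hu : ∃ u, u ∉ D ∧ u ∈ Lay ∧ ¬ (u ∈ S ↔ c₁ ∈ S)) : False := by
  obtain ⟨u, hu, ul, us⟩ := hu
  have u1 : u ≠ σ := by rintro rfl; exact l2 ul
  have u2 : u ≠ c₁ := by rintro rfl; exact us Iff.rfl
  have ub : ¬ G.Adj u c₁ := fun a => us (hS _ _ ul l1 a)
  have ua := (good_dom h hu u2 u1).resolve_left ub
  obtain ⟨y, hy, y1, y2, uy, ya, yb⟩ := good_B h hu u2 u1 ub ua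
  have yl : y ∉ Lay := fun yl => us ((hS _ _ ul yl uy).trans (hS _ _ yl l1 ya))
  obtain rfl : y = τ := (hall y yl).resolve_left y2
  obtain ⟨a, ha, a1, a2, yaa, aa, ab⟩ := good_C h hy y1 y2 ya yb
  have al := hstar _ _ yl yaa
  obtain ⟨b, hb, b1, b2, hab, ba, bb⟩ := good_A h ha a1 a2 aa ab
  have bl := hstar _ _ l2 bb.symm
  have nb := h2 a b al bl hab ab yaa.symm bb
  obtain ⟨c, hc, c1, c2, hbc, ca, cb⟩ := good_B h hb b1 b2 ba bb
  have cl : c ∈ Lay := by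
    by_contra cl
    rcases hall c cl with rfl | rfl
    · exact c2 rfl
    · exact nb hbc
  obtain ⟨a', ha', a1', a2', hca, aa', ab'⟩ := good_C h hc c1 c2 ca cb
  have al' := hstar _ _ l2 ab'.symm
  refine nb (h3 c a' c₁ b cl al' l1 bl hca aa' ca hbc.symm ?_ b1)
  rintro rfl
  exact ba aa'

end core

lemma survivor {V : Type*} [Finite V] (lay : V → Option ℤ) (Q : V → Prop) (a : ℤ) (m : ℕ)
    (hQ : ∀ j : ℕ, j < m → ∃ x, Q x ∧ lay x = some (a + j)) (D : Set V) (hD : D.ncard < m) :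
    ∃ x, x ∉ D ∧ lay x ≠ none ∧ Q x := by
  by_contra hcon
  push Not at hcon
  choose f hf using fun j : Fin m => hQ j.1 j.2
  have inj : Function.Injective f := by
    intro i j hij
    have h1 := (hf i).2
    rw [hij, (hf j).2] at h1
    simp only [Option.some.injEq] at h1
    ext; omega
  have hsub : Set.range f ⊆ D := by
    rintro _ ⟨j, rfl⟩
    by_contra hj
    exact hcon _ hj (by rw [(hf j).2]; simp) (hf j).1
  have := Set.ncard_le_ncard hsub (Set.toFinite D)
  rw [← Set.image_univ, Set.ncard_image_of_injective _ inj, Set.ncard_univ] at this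
  simp at this
  omega

section graph
variable {n k : ℕ} {E : Fin n × Fin k → Fin n × Fin k → Prop} {s t : Fin n × Fin k}

/-- The component of `s` in the layered part. -/
def SC (E : Fin n × Fin k → Fin n × Fin k → Prop) (s t : Fin n × Fin k) : Set (Vert n k s t) :=
  fun x => match x with
  | Sum.inl v => Relation.ReflTransGen E s v
  | Sum.inr (Sum.inl a) => Relation.ReflTransGen E s (a.1, t.2)
  | Sum.inr (Sum.inr _) => False

abbrev GG (E : Fin n × Fin k → Fin n × Fin k → Prop) (s t : Fin n × Fin k) :
    SimpleGraph (Vert n k s t) := SimpleGraph.fromRel (GRel E s t)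

abbrev P0 (n k : ℕ) (s t : Fin n × Fin k) : Vert n k s t :=
  Sum.inr (Sum.inr (Sum.inr (Sum.inr 0)))
abbrev P1 (n k : ℕ) (s t : Fin n × Fin k) : Vert n k s t :=
  Sum.inr (Sum.inr (Sum.inr (Sum.inr 1)))

lemma layer_none (x : Vert n k s t) (h : layer x = none) : x = P0 n k s t ∨ x = P1 n k s t := by
  rcases x with ⟨a, i⟩ | a | a | a | a
  · simp [layer] at h
  · simp [layer] at h
  · simp [layer] at h
  · simp [layer] at h
  · fin_cases a
    · exact Or.inl rfl
    · exact Or.inr rfl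

lemma layer_P0 : layer (P0 n k s t) = none := rfl
lemma layer_P1 : layer (P1 n k s t) = none := rfl

lemma adj_P0 (x : Vert n k s t) :
    (GG E s t).Adj x (P0 n k s t) ↔ ∃ i, layer x = some i ∧ (i % 3 = 0 ∨ i % 3 = 2) := by
  constructor
  · rintro ⟨_, h | h⟩
    · generalize hy : P0 n k s t = y at h
      cases h with
      | cOne h _ => subst hy; simp [layer_P0] at h
      | cTwo h _ => subst hy; simp [layer_P0] at h
      | _ => cases hy
    · generalize hy : P0 n k s t = y at h
      cases h with
      | cOne h h' => exact ⟨_, h, h'⟩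
      | cTwo h h' => cases hy
      | _ => cases hy
  · rintro ⟨i, h, h'⟩
    refine ⟨?_, Or.inr (GRel.cOne h h')⟩
    rintro rfl
    simp [layer_P0] at h

lemma adj_P1 (x : Vert n k s t) :
    (GG E s t).Adj x (P1 n k s t) ↔ ∃ i, layer x = some i ∧ (i % 3 = 1 ∨ i % 3 = 2) := by
  constructor
  · rintro ⟨_, h | h⟩
    · generalize hy : P1 n k s t = y at h
      cases h with
      | cOne h _ => subst hy; simp [layer_P1] at h
      | cTwo h _ => subst hy; simp [layer_P1] at h
      | _ => cases hy
    · generalize hy : P1 n k s t = y at h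
      cases h with
      | cTwo h h' => exact ⟨_, h, h'⟩
      | cOne h h' => cases hy
      | _ => cases hy
  · rintro ⟨i, h, h'⟩
    refine ⟨?_, Or.inr (GRel.cTwo h h')⟩
    rintro rfl
    simp [layer_P1] at h

/-- Basic facts about directed layered edges. -/
lemma rel_facts (hE : MatchedLayered E) (hs : (s.2 : ℕ) = 0) (ht : (t.2 : ℕ) + 1 = k)
    {x y : Vert n k s t} (h : GRel E s t x y) {i j : ℤ} (hi : layer x = some i)
    (hj : layer y = some j) :
    (x ∈ SC E s t ↔ y ∈ SC E s t) ∧ i % 3 ≠ j % 3 ∧ 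
    (x ∈ SC E s t → j = i + 1) := by
  have hs0 : ∀ a : Fin n, Relation.ReflTransGen E s (a, s.2) → a = s.1 := by
    intro a ha
    rcases Relation.ReflTransGen.cases_tail ha with h | ⟨c, _, h⟩
    · exact congrArg Prod.fst h
    · have := hE.1 _ _ h
      simp at this; omega
  cases h with
  | @base v w e =>
    have h1 := hE.1 _ _ e
    simp only [layer, Option.some.injEq] at hi hj
    refine ⟨⟨fun h => Relation.ReflTransGen.tail h e, fun h => ?_⟩, by omega, fun _ => by omega⟩
    rcases Relation.ReflTransGen.cases_tail h with h | ⟨c, h, e'⟩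
    · rw [h] at h1; omega
    · have : c = v := (hE.2.2 w (by omega)).unique e' e
      subst this; exact h
  | plus a =>
    simp only [layer, Option.some.injEq] at hi hj
    exact ⟨Iff.rfl, by omega, fun _ => by omega⟩
  | zero a =>
    simp only [layer, Option.some.injEq] at hi hj
    have hn : ¬ (Sum.inl (a.1, s.2) : Vert n k s t) ∈ SC E s t := fun h => a.2 (hs0 _ h)
    exact ⟨⟨fun h => (hn h).elim, fun h => h.elim⟩, by omega, fun h => (hn h).elim⟩
  | zeroMinus a =>
    simp only [layer, Option.some.injEq] at hi hj
    exact ⟨Iff.rfl, by omega, fun h => h.elim⟩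
  | minusBase a =>
    simp only [layer, Option.some.injEq] at hi hj
    have hn : ¬ (Sum.inl (a.1, s.2) : Vert n k s t) ∈ SC E s t := fun h => a.2 (hs0 _ h)
    exact ⟨⟨fun h => h.elim, fun h => (hn h).elim⟩, by omega, fun h => h.elim⟩
  | cOne _ _ => simp [layer] at hi
  | cTwo _ _ => simp [layer] at hi

lemma adj_facts (hE : MatchedLayered E) (hs : (s.2 : ℕ) = 0) (ht : (t.2 : ℕ) + 1 = k)
    {x y : Vert n k s t} (h : (GG E s t).Adj x y) {i j : ℤ} (hi : layer x = some i)
    (hj : layer y = some j) :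
    (x ∈ SC E s t ↔ y ∈ SC E s t) ∧ i % 3 ≠ j % 3 ∧ 
    (x ∈ SC E s t → j = i + 1 ∨ i = j + 1) := by
  obtain ⟨_, h | h⟩ := h
  · obtain ⟨a, b, c⟩ := rel_facts hE hs ht h hi hj
    exact ⟨a, b, fun h => Or.inl (c h)⟩
  · obtain ⟨a, b, c⟩ := rel_facts hE hs ht h hj hi
    exact ⟨a.symm, b.symm, fun h => Or.inr (c (a.2 h))⟩

/-- Explicit layered adjacency. -/
def AdjX (E : Fin n × Fin k → Fin n × Fin k → Prop) (s t : Fin n × Fin k) :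
    Vert n k s t → Vert n k s t → Prop
  | Sum.inl v, Sum.inl w => E v w ∨ E w v
  | Sum.inl v, Sum.inr (Sum.inl a) => v = (a.1, t.2)
  | Sum.inl v, Sum.inr (Sum.inr (Sum.inl a)) => v = (a.1, s.2)
  | Sum.inl v, Sum.inr (Sum.inr (Sum.inr (Sum.inl a))) => v = (a.1, s.2)
  | Sum.inr (Sum.inl a), Sum.inl v => v = (a.1, t.2)
  | Sum.inr (Sum.inr (Sum.inl a)), Sum.inl v => v = (a.1, s.2)
  | Sum.inr (Sum.inr (Sum.inr (Sum.inl a))), Sum.inl v => v = (a.1, s.2)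
  | Sum.inr (Sum.inr (Sum.inl a)), Sum.inr (Sum.inr (Sum.inr (Sum.inl b))) => a = b
  | Sum.inr (Sum.inr (Sum.inr (Sum.inl b))), Sum.inr (Sum.inr (Sum.inl a)) => a = b
  | _, _ => False

lemma adjX_of_adj {x y : Vert n k s t} (h : (GG E s t).Adj x y) (hi : layer x ≠ none)
    (hj : layer y ≠ none) : AdjX E s t x y := by
  obtain ⟨_, h | h⟩ := h
  · cases h with
    | base e => exact Or.inl e
    | cOne _ _ => exact (hi rfl).elim
    | cTwo _ _ => exact (hi rfl).elim
    | _ => rfl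
  · cases h with
    | base e => exact Or.inr e
    | cOne _ _ => exact (hj rfl).elim
    | cTwo _ _ => exact (hj rfl).elim
    | _ => rfl

lemma triangle (hE : MatchedLayered E) (hs : (s.2 : ℕ) = 0) (ht : (t.2 : ℕ) + 1 = k)
    (x y z w : Vert n k s t) (hxy : AdjX E s t x y) (hyz : AdjX E s t y z)
    (hxz : AdjX E s t x z) (hxw : AdjX E s t x w) (h1 : w ≠ y) (h2 : w ≠ z) :
    layer w = some 2 := by
  have hl : ∀ v w, E v w → (w.2 : ℕ) = (v.2 : ℕ) + 1 := hE.1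
  rcases x with ⟨x, x'⟩ | x | x | x | x <;> rcases y with ⟨y, y'⟩ | y | y | y | y <;>
    first
    | exact hxy.elim
    | (rcases z with ⟨z, z'⟩ | z | z | z | z <;>
        first
        | exact hyz.elim
        | exact hxz.elim
        | (rcases w with ⟨w, w'⟩ | w | w | w | w <;>
            first
            | exact hxw.elim
            | (simp only [AdjX, Prod.mk.injEq] at hxy hyz hxz hxw
               simp only [layer, Option.some.injEq]
               clear hE
               grind)))

end graph

/-- if at most `k` vertices can be deleted from `G′` so that the
remaining induced subgraph satisfies property `P`, then `t` is reachable from `s`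
in the matched layered graph `G`. -/
theorem stmt_7 {n k : ℕ} (E : Fin n × Fin k → Fin n × Fin k → Prop)
    (hE : MatchedLayered E) (s t : Fin n × Fin k)
    (hs : (s.2 : ℕ) = 0) (ht : (t.2 : ℕ) + 1 = k)
    (hdel : ∃ D : Set (Vert n k s t), D.ncard ≤ k ∧
      PropP ((SimpleGraph.fromRel (GRel E s t)).induce Dᶜ)) :
    Relation.ReflTransGen E s t := by
  by_contra hst
  obtain ⟨D, hD, hP⟩ := hdel
  obtain ⟨c₁, c₂, hc1, hc2, h, hne12⟩ := good_of_propP _ D hP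
  have : Finite (Vert n k s t) := by unfold Vert; infer_instance
  let Lay : Set (Vert n k s t) := {x | layer x ≠ none}
  have lay_ex : ∀ x, x ∈ Lay → ∃ i, layer x = some i := fun x hx =>
    Option.ne_none_iff_exists'.1 hx
  have lay_some : ∀ (x : Vert n k s t) i, layer x = some i → x ∈ Lay := fun x i h => by
    simp [Lay, h]
  have n0 : P0 n k s t ∉ Lay := fun h => h rfl
  have n1 : P1 n k s t ∉ Lay := fun h => h rfl
  have hall : ∀ x, x ∉ Lay → x = P0 n k s t ∨ x = P1 n k s t := fun x hx =>
    layer_none x (by simpa [Lay] using hx)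
  have hstar : ∀ x y, x ∉ Lay → (GG E s t).Adj x y → y ∈ Lay := by
    intro x y hx a
    rcases hall x hx with rfl | rfl
    · obtain ⟨i, hi, _⟩ := (adj_P0 y).1 a.symm
      exact lay_some _ _ hi
    · obtain ⟨i, hi, _⟩ := (adj_P1 y).1 a.symm
      exact lay_some _ _ hi
  have hS : ∀ x y, x ∈ Lay → y ∈ Lay → (GG E s t).Adj x y →
      (x ∈ SC E s t ↔ y ∈ SC E s t) := by
    intro x y hx hy a
    obtain ⟨i, hi⟩ := lay_ex x hx
    obtain ⟨j, hj⟩ := lay_ex y hy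
    exact (adj_facts hE hs ht a hi hj).1
  have h2 : ∀ a b, a ∈ Lay → b ∈ Lay → (GG E s t).Adj a b → (GG E s t).Adj a (P0 n k s t) →
      (GG E s t).Adj a (P1 n k s t) → (GG E s t).Adj b (P0 n k s t) →
      ¬ (GG E s t).Adj b (P1 n k s t) := by
    intro a b ha hb hab a0 a1 b0 b1
    obtain ⟨i, hi⟩ := lay_ex a ha
    obtain ⟨j, hj⟩ := lay_ex b hb
    have := (adj_facts hE hs ht hab hi hj).2.1
    rw [adj_P0] at a0 b0
    rw [adj_P1] at a1 b1
    simp only [hi, hj, Option.some.injEq, exists_eq_left'] at a0 a1 b0 b1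
    omega
  have h3 : ∀ x y z w, x ∈ Lay → y ∈ Lay → z ∈ Lay → w ∈ Lay → (GG E s t).Adj x y →
      (GG E s t).Adj y z → (GG E s t).Adj x z → (GG E s t).Adj x w → w ≠ y → w ≠ z →
      layer w = some 2 := by
    intro x y z w hx hy hz hw a b c d e f
    exact triangle hE hs ht x y z w (adjX_of_adj a hx hy) (adjX_of_adj b hy hz)
      (adjX_of_adj c hx hz) (adjX_of_adj d hx hw) e f
  -- existence of vertices on layers
  have fwd : ∀ j : ℕ, j < k → ∃ v : Fin n × Fin k, (v.2 : ℕ) = j ∧ Relation.ReflTransGen E s v := by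
    intro j
    induction j with
    | zero => intro _; exact ⟨s, hs, .refl⟩
    | succ j ih =>
      intro hj
      obtain ⟨v, hv, r⟩ := ih (by omega)
      obtain ⟨w, hw, _⟩ := hE.2.1 v (by omega)
      exact ⟨w, by rw [hE.1 _ _ hw, hv], r.tail hw⟩
  have bwd : ∀ j : ℕ, j < k → ∃ v : Fin n × Fin k, (v.2 : ℕ) + j + 1 = k ∧
      Relation.ReflTransGen E v t := by
    intro j
    induction j with
    | zero => intro _; exact ⟨t, ht, .refl⟩
    | succ j ih =>
      intro hj
      obtain ⟨v, hv, r⟩ := ih (by omega)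
      obtain ⟨w, hw, _⟩ := hE.2.2 v (by omega)
      have := hE.1 _ _ hw
      exact ⟨w, by omega, .head hw r⟩
  have exS : ∀ j : ℕ, j < k + 1 → ∃ x, x ∈ SC E s t ∧ layer x = some ((1 : ℤ) + j) := by
    intro j hj
    by_cases hjk : j < k
    · obtain ⟨v, hv, r⟩ := fwd j hjk
      refine ⟨Sum.inl v, r, ?_⟩
      simp only [layer, Option.some.injEq]; omega
    · obtain ⟨v, hv, r⟩ := fwd (k - 1) (by omega)
      have e2 : v.2 = t.2 := by ext; omega
      have hne : v.1 ≠ t.1 := fun e => hst (by rwa [Prod.ext e e2] at r)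
      refine ⟨Sum.inr (Sum.inl ⟨v.1, hne⟩), ?_, ?_⟩
      · change Relation.ReflTransGen E s (v.1, t.2)
        rwa [← e2]
      · simp only [layer, Option.some.injEq]; omega
  obtain ⟨b, hb⟩ : ∃ b : Fin n, b ≠ s.1 := by
    obtain ⟨v, hv, r⟩ := bwd (k - 1) (by omega)
    refine ⟨v.1, fun e => hst ?_⟩
    have e2 : v.2 = s.2 := by ext; omega
    rwa [Prod.ext e e2] at r
  have exT : ∀ j : ℕ, j < k + 1 → ∃ x, x ∉ SC E s t ∧ layer x = some ((0 : ℤ) + j) := by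
    intro j hj
    rcases j with _ | j
    · exact ⟨Sum.inr (Sum.inr (Sum.inl ⟨b, hb⟩)), fun h => h.elim, by simp [layer]⟩
    · obtain ⟨v, hv, r⟩ := bwd (k - 1 - j) (by omega)
      refine ⟨Sum.inl v, fun h => hst (Relation.ReflTransGen.trans h r), ?_⟩
      simp only [layer, Option.some.injEq]; omega
  have exA : ∀ j : ℕ, j < k + 3 → ∃ x : Vert n k s t, True ∧ layer x = some ((-1 : ℤ) + j) := by
    intro j hj
    rcases j with _ | _ | j
    · exact ⟨Sum.inr (Sum.inr (Sum.inr (Sum.inl ⟨b, hb⟩))), trivial, by simp [layer]⟩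
    · exact ⟨Sum.inr (Sum.inr (Sum.inl ⟨b, hb⟩)), trivial, by simp [layer]⟩
    · obtain ⟨x, _, hx⟩ := exS j (by omega)
      refine ⟨x, trivial, ?_⟩
      rw [hx]; simp only [Option.some.injEq]; push_cast; ring
  have svS := survivor layer (· ∈ SC E s t) 1 (k + 1) exS D (by omega)
  have svT := survivor layer (· ∉ SC E s t) 0 (k + 1) exT D (by omega)
  have svA : ∃ x, x ∉ D ∧ x ≠ c₁ ∧ x ≠ c₂ := by
    obtain ⟨x, hx, _⟩ := survivor layer (fun _ => True) (-1) (k + 3) exA (insert c₁ (insert c₂ D))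
      (by
        have := Set.ncard_insert_le c₁ (insert c₂ D)
        have := Set.ncard_insert_le c₂ D
        omega)
    simp only [Set.mem_insert_iff, not_or] at hx
    exact ⟨x, hx.2.2, hx.1, hx.2.1⟩
  have svU : ∀ e, ∃ u, u ∉ D ∧ u ∈ Lay ∧ ¬ (u ∈ SC E s t ↔ e ∈ SC E s t) := by
    intro e
    by_cases he : e ∈ SC E s t
    · obtain ⟨u, a, b, c⟩ := svT
      exact ⟨u, a, b, fun h => c (h.2 he)⟩
    · obtain ⟨u, a, b, c⟩ := svS
      exact ⟨u, a, b, fun h => he (h.1 c)⟩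
  by_cases l1 : c₁ ∈ Lay
  · by_cases l2 : c₂ ∈ Lay
    · exact core0 h hstar hS l1 l2 svS svT svA
    · rcases hall c₂ l2 with rfl | rfl
      · refine core1a (τ := P1 n k s t) h hall hstar hS h2 ?_ l1 l2 n1 (svU _)
        intro x y z w hx hy hz hw a b c d e f
        exact (adj_P1 w).2 ⟨2, h3 x y z w hx hy hz hw a b c d e f, by norm_num⟩
      · refine core1a (τ := P0 n k s t) h (fun x hx => (hall x hx).symm) hstar hS
          (fun a b ha hb hab p q r r' => h2 a b ha hb hab q p r' r) ?_ l1 l2 n0 (svU _)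
        intro x y z w hx hy hz hw a b c d e f
        exact (adj_P0 w).2 ⟨2, h3 x y z w hx hy hz hw a b c d e f, by norm_num⟩
  · by_cases l2 : c₂ ∈ Lay
    · exact core1b h hstar hS l1 l2 (svU _)
    · -- both centres are stars
      obtain ⟨x, hxD, hxl, hxS⟩ := svS
      have hne : ∀ x ∈ Lay, x ≠ c₁ ∧ x ≠ c₂ := fun x hx =>
        ⟨fun e => l1 (e ▸ hx), fun e => l2 (e ▸ hx)⟩
      have bound : ∀ (x : Vert n k s t) i, x ∈ SC E s t → layer x = some i → 
          1 ≤ i ∧ i ≤ k + 1 := by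
        intro x i hx hi
        rcases x with ⟨a, j⟩ | a | a
        · simp only [layer, Option.some.injEq] at hi
          have := j.2
          omega
        · simp only [layer, Option.some.injEq] at hi
          omega
        · exact hx.elim
      have c12 : c₁ ≠ c₂ := hne12 x hxD (hne x hxl).1 (hne x hxl).2
      obtain ⟨i, hi⟩ := lay_ex x hxl
      have nostar : ∀ y, y ≠ c₁ → y ≠ c₂ → y ∈ Lay := by
        intro y y1 y2
        by_contra hy
        have a := hall y hy
        have b := hall c₁ l1
        have c := hall c₂ l2
        grind
      have step : (∀ x i, x ∉ D → x ∈ SC E s t → layer x = some i →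
            ∃ y, y ∉ D ∧ y ∈ SC E s t ∧ layer y = some (i - 1)) ∨
          (∀ x i, x ∉ D → x ∈ SC E s t → layer x = some i →
            ∃ y, y ∉ D ∧ y ∈ SC E s t ∧ layer y = some (i + 1)) := by
        rcases hall c₁ l1 with rfl | rfl <;> rcases hall c₂ l2 with rfl | rfl
        · exact (c12 rfl).elim
        · left
          intro x i hx hxS hi
          have hxl := lay_some x i hi
          obtain ⟨y, hy, y1, y2, e3, e4, e5, e6, e7⟩ := h x hx (hne x hxl).1 (hne x hxl).2
          have hyl := nostar y y1 y2
          obtain ⟨j, hj⟩ := lay_ex y hyl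
          obtain ⟨f1, f2, f3⟩ := adj_facts hE hs ht e4 hi hj
          refine ⟨y, hy, f1.1 hxS, ?_⟩
          have f3 := f3 hxS
          have q0 := adj_P0 (E := E) x
          have q1 := adj_P1 (E := E) x
          have q2 := adj_P0 (E := E) y
          have q3 := adj_P1 (E := E) y
          simp only [hi, hj, Option.some.injEq, exists_eq_left'] at q0 q1 q2 q3
          simp only [q0, q1, q2, q3] at e3 e5 e6 e7
          rw [hj]
          simp only [Option.some.injEq]
          omega
        · right
          intro x i hx hxS hi
          have hxl := lay_some x i hi
          obtain ⟨y, hy, y1, y2, e3, e4, e5, e6, e7⟩ := h x hx (hne x hxl).1 (hne x hxl).2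
          have hyl := nostar y y1 y2
          obtain ⟨j, hj⟩ := lay_ex y hyl
          obtain ⟨f1, f2, f3⟩ := adj_facts hE hs ht e4 hi hj
          refine ⟨y, hy, f1.1 hxS, ?_⟩
          have f3 := f3 hxS
          have q0 := adj_P0 (E := E) x
          have q1 := adj_P1 (E := E) x
          have q2 := adj_P0 (E := E) y
          have q3 := adj_P1 (E := E) y
          simp only [hi, hj, Option.some.injEq, exists_eq_left'] at q0 q1 q2 q3
          simp only [q0, q1, q2, q3] at e3 e5 e6 e7
          rw [hj]
          simp only [Option.some.injEq]
          omega
        · exact (c12 rfl).elim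
      rcases step with step | step
      · have : ∀ m : ℕ, ∀ x i, x ∉ D → x ∈ SC E s t → layer x = some i → i ≤ m → False := by
          intro m
          induction m with
          | zero =>
            intro x i hx hxS hi him
            have := bound x i hxS hi
            push_cast at him
            omega
          | succ m ih =>
            intro x i hx hxS hi him
            obtain ⟨y, hy, hyS, hyl⟩ := step x i hx hxS hi
            exact ih y _ hy hyS hyl (by push_cast at him; omega)
        exact this (k + 1) x i hxD hxS hi (by have := bound x i hxS hi; push_cast; omega)
      · have : ∀ m : ℕ, ∀ x i, x ∉ D → x ∈ SC E s t → layer x = some i →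
            (k : ℤ) + 2 ≤ i + m → False := by
          intro m
          induction m with
          | zero =>
            intro x i hx hxS hi him
            have := bound x i hxS hi
            push_cast at him
            omega
          | succ m ih =>
            intro x i hx hxS hi him
            obtain ⟨y, hy, hyS, hyl⟩ := step x i hx hxS hi
            exact ih y _ hy hyS hyl (by push_cast at him; omega)
        exact this (k + 1) x i hxD hxS hi (by have := bound x i hxS hi; push_cast; omega)
end
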